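/- Let Q ∈ ℝ^{m×n} with nuclear norm ‖Q‖_* > 1, and SVD Q = U[Diag(σ(Q)) 0]Vᵀ. Then there is a unique λ* > 0 with Σ_{i=1}^m [σ_i(Q) − λ*]₊ = 1, and the proximal mapping of the spectral norm satisfies Prox_θ(Q) = U[Diag(min{σ₁(Q),λ*}, …, min{σ_m(Q),λ*}) 0]Vᵀ; moreover λ* = ‖Prox_θ(Q)‖₂, i.e., λ* equals the largest singular value of Prox_θ(Q). -/

import Mathlib

open Matrix Filter Set RealInnerProductSpace

noncomputable section

/-- Trace inner product on real matrices: `⟨A,B⟩ = trace (Aᵀ B)`. -/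
def minner {ι κ : Type*} [Fintype ι] [Fintype κ] (A B : Matrix ι κ ℝ) : ℝ :=
  (Aᵀ * B).trace

/-- Frobenius norm. -/
def fnorm {ι κ : Type*} [Fintype ι] [Fintype κ] (A : Matrix ι κ ℝ) : ℝ :=
  Real.sqrt (minner A A)

/-- Spectral norm (largest singular value), as the ℓ²-operator norm. -/
def specNorm {ι κ : Type*} [Fintype ι] [Fintype κ] (A : Matrix ι κ ℝ) : ℝ :=
  sSup {r : ℝ | ∃ x : κ → ℝ, ∑ j, x j ^ 2 = 1 ∧
    r = Real.sqrt (∑ i, (∑ j, A i j * x j) ^ 2)}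

/-- Convex subdifferential with respect to the trace inner product. -/
def subdiff {ι κ : Type*} [Fintype ι] [Fintype κ] (f : Matrix ι κ ℝ → ℝ)
    (X : Matrix ι κ ℝ) : Set (Matrix ι κ ℝ) :=
  {G | ∀ Y, f X + minner G (Y - X) ≤ f Y}

/-- One-sided directional derivative. -/
def dirDeriv {ι κ : Type*} [Fintype ι] [Fintype κ] (f : Matrix ι κ ℝ → ℝ)
    (X D : Matrix ι κ ℝ) : ℝ :=
  limUnder (nhdsWithin (0 : ℝ) (Set.Ioi 0)) fun t => (f (X + t • D) - f X) / t

/-- Critical cone of the spectral norm θ at `P` for `W`. -/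
def critTheta {ι κ : Type*} [Fintype ι] [Fintype κ] (P W : Matrix ι κ ℝ) :
    Set (Matrix ι κ ℝ) :=
  {D | dirDeriv specNorm P D = minner D W}

/-- Conjugate θ* of the spectral norm, as an extended-real-valued function
(it is the indicator of the nuclear norm unit ball). -/
def thetaStar {ι κ : Type*} [Fintype ι] [Fintype κ] (W : Matrix ι κ ℝ) : EReal :=
  ⨆ X : Matrix ι κ ℝ, ((minner W X - specNorm X : ℝ) : EReal)

/-- Lower directional epiderivative of an extended-real-valued function. -/
def epiDeriv {ι κ : Type*} [Fintype ι] [Fintype κ] (g : Matrix ι κ ℝ → EReal)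
    (X D : Matrix ι κ ℝ) : EReal :=
  liminf (fun p : ℝ × Matrix ι κ ℝ =>
      (((p.1)⁻¹ : ℝ) : EReal) * (g (X + p.1 • p.2) - g X))
    ((nhdsWithin (0 : ℝ) (Set.Ioi 0)) ×ˢ nhds D)

/-- Critical cone of θ* at `W` for `P`. -/
def critThetaStar {ι κ : Type*} [Fintype ι] [Fintype κ] (W P : Matrix ι κ ℝ) :
    Set (Matrix ι κ ℝ) :=
  {D | epiDeriv thetaStar W D = ((minner D P : ℝ) : EReal)}

/-- Second-order directional derivative. -/
def dirDeriv2 {ι κ : Type*} [Fintype ι] [Fintype κ] (f : Matrix ι κ ℝ → ℝ)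
    (X D W' : Matrix ι κ ℝ) : ℝ :=
  limUnder (nhdsWithin (0 : ℝ) (Set.Ioi 0)) fun t =>
    (f (X + t • D + (t ^ 2 / 2) • W') - f X - t * dirDeriv f X D) / (t ^ 2 / 2)

/-- The sigma term of θ: `ψ*_{(P,D)}(W) = (θ''(P;D,·))*(W)`. -/
def sigmaTheta {ι κ : Type*} [Fintype ι] [Fintype κ] (P D W : Matrix ι κ ℝ) : EReal :=
  ⨆ Z : Matrix ι κ ℝ, ((minner W Z - dirDeriv2 specNorm P D Z : ℝ) : EReal)

/-- Lower second-order directional epiderivative of an EReal-valued function. -/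
def epiDeriv2 {ι κ : Type*} [Fintype ι] [Fintype κ] (g : Matrix ι κ ℝ → EReal)
    (X D W' : Matrix ι κ ℝ) : EReal :=
  liminf (fun p : ℝ × Matrix ι κ ℝ =>
      ((2 / p.1 ^ 2 : ℝ) : EReal) *
        (g (X + p.1 • D + (p.1 ^ 2 / 2) • p.2) - g X - (p.1 : ℝ) * epiDeriv g X D))
    ((nhdsWithin (0 : ℝ) (Set.Ioi 0)) ×ˢ nhds W')

/-- The sigma term of θ*: `φ*_{(W,H)}(P) = ((θ*)''(W;H,·))*(P)`. -/
def sigmaThetaStar {ι κ : Type*} [Fintype ι] [Fintype κ] (W H P : Matrix ι κ ℝ) : EReal :=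
  ⨆ Z : Matrix ι κ ℝ, (((minner P Z : ℝ) : EReal) - epiDeriv2 thetaStar W H Z)

/-- Polar cone with respect to the trace inner product. -/
def polarCone {ι κ : Type*} [Fintype ι] [Fintype κ] (K : Set (Matrix ι κ ℝ)) :
    Set (Matrix ι κ ℝ) :=
  {H | ∀ D ∈ K, minner H D ≤ 0}

/-- Rectangular diagonal matrix `[Diag σ  0]`. -/
def diagRect {m n : ℕ} (σ : Fin m → ℝ) : Matrix (Fin m) (Fin n) ℝ :=
  Matrix.of fun i j => if (j : ℕ) = (i : ℕ) then σ i else 0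

/-- Symmetric part `S(A₁)` of the left m×m block of an m×n matrix. -/
def symLeft {m n : ℕ} (hmn : m ≤ n) (A : Matrix (Fin m) (Fin n) ℝ) :
    Matrix (Fin m) (Fin m) ℝ :=
  Matrix.of fun i j => (A i (Fin.castLE hmn j) + A j (Fin.castLE hmn i)) / 2

/-- Skew-symmetric part `T(A₁)` of the left m×m block of an m×n matrix. -/
def skewLeft {m n : ℕ} (hmn : m ≤ n) (A : Matrix (Fin m) (Fin n) ℝ) :
    Matrix (Fin m) (Fin m) ℝ :=
  Matrix.of fun i j => (A i (Fin.castLE hmn j) - A j (Fin.castLE hmn i)) / 2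

/-- Quadratic form `xᵀ A x`. -/
def quadForm {m : ℕ} (A : Matrix (Fin m) (Fin m) ℝ) (x : Fin m → ℝ) : ℝ :=
  ∑ i, ∑ j, x i * A i j * x j

/-- Proximal mapping. -/
def prox {ι κ : Type*} [Fintype ι] [Fintype κ] (f : Matrix ι κ ℝ → ℝ)
    (Z : Matrix ι κ ℝ) : Matrix ι κ ℝ :=
  Classical.epsilon fun Y =>
    ∀ X, f Y + (1 / 2) * fnorm (Y - Z) ^ 2 ≤ f X + (1 / 2) * fnorm (X - Z) ^ 2

/-- Directional derivative of the proximal mapping. -/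
def proxDeriv {ι κ : Type*} [Fintype ι] [Fintype κ] (f : Matrix ι κ ℝ → ℝ)
    (Z D : Matrix ι κ ℝ) : Matrix ι κ ℝ :=
  limUnder (nhdsWithin (0 : ℝ) (Set.Ioi 0)) fun t =>
    t⁻¹ • (prox f (Z + t • D) - prox f Z)

end

section SpectralNorm

variable {ι κ : Type*} [Fintype ι] [Fintype κ]

lemma minner_eq_sum (A B : Matrix ι κ ℝ) : minner A B = ∑ j, ∑ i, A i j * B i j := by
  simp [minner, Matrix.trace, Matrix.mul_apply]

lemma fnorm_sq (A : Matrix ι κ ℝ) : fnorm A ^ 2 = minner A A := by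
  rw [fnorm, Real.sq_sqrt]
  rw [minner_eq_sum]
  exact Finset.sum_nonneg fun _ _ => Finset.sum_nonneg fun _ _ => mul_self_nonneg _

lemma fnorm_eq_zero {A : Matrix ι κ ℝ} (h : fnorm A ^ 2 ≤ 0) : A = 0 := by
  rw [fnorm_sq, minner_eq_sum] at h
  have hcol : ∀ j ∈ Finset.univ, 0 ≤ ∑ i, A i j * A i j := fun _ _ =>
    Finset.sum_nonneg fun _ _ => mul_self_nonneg _
  have h0 := (Finset.sum_eq_zero_iff_of_nonneg hcol).1 (le_antisymm h (Finset.sum_nonneg hcol))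
  ext i j
  have := (Finset.sum_eq_zero_iff_of_nonneg fun _ _ => mul_self_nonneg _).1
    (h0 j (Finset.mem_univ j)) i (Finset.mem_univ i)
  simpa using this

lemma le_specNorm (A : Matrix ι κ ℝ) (x : κ → ℝ) (hx : ∑ j, x j ^ 2 = 1) :
    Real.sqrt (∑ i, (∑ j, A i j * x j) ^ 2) ≤ specNorm A := by
  refine le_csSup ⟨Real.sqrt (∑ i, ∑ j, A i j ^ 2), ?_⟩ ⟨x, hx, rfl⟩
  rintro r ⟨y, hy, rfl⟩
  refine Real.sqrt_le_sqrt (Finset.sum_le_sum fun i _ => ?_)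
  simpa [hy] using Finset.sum_mul_sq_le_sq_mul_sq Finset.univ (A i) y

lemma bilinear_le_specNorm (A : Matrix ι κ ℝ) (u : ι → ℝ) (v : κ → ℝ)
    (hu : ∑ i, u i ^ 2 = 1) (hv : ∑ j, v j ^ 2 = 1) :
    ∑ i, u i * ∑ j, A i j * v j ≤ specNorm A := by
  refine le_trans (Real.le_sqrt_of_sq_le ?_) (le_specNorm A v hv)
  simpa [hu] using
    Finset.sum_mul_sq_le_sq_mul_sq Finset.univ u (fun i => ∑ j, A i j * v j)

/-- If `Q - P` is a subgradient of `f` at `P`, then `P` is the proximal point of `Q`. -/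
lemma prox_eq_of_subgradient {f : Matrix ι κ ℝ → ℝ} {P Q : Matrix ι κ ℝ}
    (h : Q - P ∈ subdiff f P) : prox f Q = P := by
  have key : ∀ X, f P + (1 / 2) * fnorm (P - Q) ^ 2 + (1 / 2) * fnorm (X - P) ^ 2
      ≤ f X + (1 / 2) * fnorm (X - Q) ^ 2 := by
    intro X
    have hX := h X
    have hid : fnorm (X - Q) ^ 2
        = fnorm (P - Q) ^ 2 + fnorm (X - P) ^ 2 - 2 * minner (Q - P) (X - P) := by
      simp only [fnorm_sq, minner_eq_sum, Finset.mul_sum, ← Finset.sum_add_distrib,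
        ← Finset.sum_sub_distrib, Matrix.sub_apply]
      exact Finset.sum_congr rfl fun _ _ => Finset.sum_congr rfl fun _ _ => by ring
    linarith
  have hmin : ∀ X, f P + (1 / 2) * fnorm (P - Q) ^ 2 ≤ f X + (1 / 2) * fnorm (X - Q) ^ 2 :=
    fun X => by linarith [key X, sq_nonneg (fnorm (X - P))]
  have hspec : ∀ X, f (prox f Q) + (1 / 2) * fnorm (prox f Q - Q) ^ 2
      ≤ f X + (1 / 2) * fnorm (X - Q) ^ 2 :=
    Classical.epsilon_spec (p := fun Y => ∀ X, f Y + (1 / 2) * fnorm (Y - Q) ^ 2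
      ≤ f X + (1 / 2) * fnorm (X - Q) ^ 2) ⟨P, hmin⟩
  exact sub_eq_zero.1 (fnorm_eq_zero (by linarith [key (prox f Q), hspec P]))

end SpectralNorm

lemma sum_sq_col_eq_one {ι : Type*} [Fintype ι] [DecidableEq ι] {U : Matrix ι ι ℝ}
    (hU : Uᵀ * U = 1) (i : ι) : ∑ k, U k i ^ 2 = 1 := by
  have := congrFun (congrFun hU i) i
  simpa [Matrix.mul_apply, sq] using this

lemma sum_sq_mulVec_of_orthogonal {ι : Type*} [Fintype ι] [DecidableEq ι] {U : Matrix ι ι ℝ}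
    (hU : Uᵀ * U = 1) (x : ι → ℝ) : ∑ i, (U *ᵥ x) i ^ 2 = ∑ i, x i ^ 2 := by
  have h : (U *ᵥ x) ⬝ᵥ (U *ᵥ x) = x ⬝ᵥ x := by
    rw [Matrix.dotProduct_mulVec, ← Matrix.mulVec_transpose, Matrix.mulVec_mulVec, hU,
      Matrix.one_mulVec]
  simpa [dotProduct, sq] using h

section RectangularDiagonal

variable {m n : ℕ} {U : Matrix (Fin m) (Fin m) ℝ} {V : Matrix (Fin n) (Fin n) ℝ}

lemma diagRect_mulVec (hmn : m ≤ n) (d : Fin m → ℝ) (y : Fin n → ℝ) (i : Fin m) :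
    ((diagRect d : Matrix (Fin m) (Fin n) ℝ) *ᵥ y) i = d i * y (Fin.castLE hmn i) := by
  rw [Matrix.mulVec, dotProduct, Finset.sum_eq_single (Fin.castLE hmn i)]
  · simp [diagRect]
  · intro j _ hj
    have : (j : ℕ) ≠ i := fun h => hj (Fin.ext h)
    simp [diagRect, this]
  · simp

lemma minner_diagRect (hmn : m ≤ n) (w : Fin m → ℝ) (X : Matrix (Fin m) (Fin n) ℝ) :
    minner (diagRect w) X = ∑ i, w i * X i (Fin.castLE hmn i) := by
  rw [minner_eq_sum, Finset.sum_comm]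
  exact Finset.sum_congr rfl fun i _ => diagRect_mulVec hmn w (X i) i

lemma minner_svd (w : Fin m → ℝ) (X : Matrix (Fin m) (Fin n) ℝ) :
    minner (U * (diagRect w : Matrix (Fin m) (Fin n) ℝ) * Vᵀ) X
      = minner (diagRect w) (Uᵀ * X * V) := by
  simp only [minner, Matrix.transpose_mul, Matrix.transpose_transpose]
  rw [Matrix.mul_assoc, Matrix.trace_mul_comm]
  simp only [Matrix.mul_assoc]

/-- Duality between the spectral norm and the nuclear norm. -/
lemma minner_svd_le (hmn : m ≤ n) (hU : Uᵀ * U = 1) (hV : Vᵀ * V = 1) {w : Fin m → ℝ}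
    (hw : ∀ i, 0 ≤ w i) (X : Matrix (Fin m) (Fin n) ℝ) :
    minner (U * (diagRect w : Matrix (Fin m) (Fin n) ℝ) * Vᵀ) X ≤ (∑ i, w i) * specNorm X := by
  rw [minner_svd, minner_diagRect hmn, Finset.sum_mul]
  refine Finset.sum_le_sum fun i _ => mul_le_mul_of_nonneg_left ?_ (hw i)
  have h := bilinear_le_specNorm X (fun k => U k i) (fun j => V j (Fin.castLE hmn i))
    (sum_sq_col_eq_one hU i) (sum_sq_col_eq_one hV _)
  rw [Matrix.mul_assoc]
  simpa [Matrix.mul_apply] using h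

lemma specNorm_svd_le (hmn : m ≤ n) (hU : Uᵀ * U = 1) (hV : Vᵀ * V = 1) {d : Fin m → ℝ} {c : ℝ}
    (hd : ∀ i, 0 ≤ d i) (hdc : ∀ i, d i ≤ c) (hc : 0 ≤ c) :
    specNorm (U * (diagRect d : Matrix (Fin m) (Fin n) ℝ) * Vᵀ) ≤ c := by
  refine Real.sSup_le ?_ hc
  rintro r ⟨x, hx, rfl⟩
  refine Real.sqrt_le_iff.2 ⟨hc, ?_⟩
  change ∑ i, ((U * (diagRect d : Matrix (Fin m) (Fin n) ℝ) * Vᵀ) *ᵥ x) i ^ 2 ≤ c ^ 2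
  have hV' : Vᵀᵀ * Vᵀ = 1 := by
    rw [Matrix.transpose_transpose]
    exact mul_eq_one_comm.1 hV
  have hy : ∑ j, (Vᵀ *ᵥ x) j ^ 2 = 1 := (sum_sq_mulVec_of_orthogonal hV' x).trans hx
  rw [Matrix.mul_assoc, ← Matrix.mulVec_mulVec, sum_sq_mulVec_of_orthogonal hU,
    ← Matrix.mulVec_mulVec]
  generalize Vᵀ *ᵥ x = y at hy
  calc ∑ i, ((diagRect d : Matrix (Fin m) (Fin n) ℝ) *ᵥ y) i ^ 2
      ≤ ∑ i, c ^ 2 * y (Fin.castLE hmn i) ^ 2 := by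
        refine Finset.sum_le_sum fun i _ => ?_
        rw [diagRect_mulVec hmn, mul_pow]
        have := pow_le_pow_left₀ (hd i) (hdc i) 2
        gcongr
    _ = c ^ 2 * ∑ j ∈ Finset.univ.map (Fin.castLEEmb hmn), y j ^ 2 := by
        rw [Finset.sum_map, Finset.mul_sum]
        rfl
    _ ≤ c ^ 2 * ∑ j, y j ^ 2 := by
        refine mul_le_mul_of_nonneg_left ?_ (sq_nonneg c)
        exact Finset.sum_le_sum_of_subset_of_nonneg (Finset.subset_univ _)
          fun _ _ _ => sq_nonneg _
    _ = c ^ 2 := by rw [hy, mul_one]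

end RectangularDiagonal

lemma existsUnique_sum_max_sub_eq_one {ι : Type*} [Fintype ι] {σ : ι → ℝ} (hσ0 : ∀ i, 0 ≤ σ i)
    (hnuc : 1 < ∑ i, σ i) : ∃! lam : ℝ, 0 < lam ∧ ∑ i, max (σ i - lam) 0 = 1 := by
  have hzero : ∑ i, max (σ i - 0) 0 = ∑ i, σ i :=
    Finset.sum_congr rfl fun i _ => by simp [hσ0 i]
  have htop : ∑ i, max (σ i - ∑ k, σ k) 0 = 0 :=
    Finset.sum_eq_zero fun i _ => max_eq_right (by
      linarith [Finset.single_le_sum (fun k _ => hσ0 k) (Finset.mem_univ i)])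
  have hcont : Continuous fun lam : ℝ => ∑ i, max (σ i - lam) 0 := by fun_prop
  obtain ⟨lam, hlam, hval⟩ := intermediate_value_Icc' (a := (0 : ℝ)) (b := ∑ i, σ i)
    (by linarith) hcont.continuousOn
    (show (1 : ℝ) ∈ Icc (∑ i, max (σ i - ∑ k, σ k) 0) (∑ i, max (σ i - 0) 0) by
      rw [hzero, htop]
      exact ⟨zero_le_one, hnuc.le⟩)
  have hstrict : ∀ a b : ℝ, a < b → ∑ i, max (σ i - b) 0 = 1 → ∑ i, max (σ i - a) 0 ≠ 1 := by
    intro a b hab hb ha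
    obtain ⟨i, -, hi⟩ : ∃ i ∈ Finset.univ, 0 < max (σ i - b) 0 :=
      Finset.exists_lt_of_sum_lt (by simp [hb])
    have hlt : ∑ i, max (σ i - b) 0 < ∑ i, max (σ i - a) 0 := by
      refine Finset.sum_lt_sum (fun k _ => max_le_max_right 0 (by linarith))
        ⟨i, Finset.mem_univ i, ?_⟩
      have hpos : 0 < σ i - b := by simpa using hi
      rw [max_eq_left hpos.le]
      exact lt_max_of_lt_left (by linarith)
    linarith
  refine ⟨lam, ⟨lt_of_le_of_ne hlam.1 ?_, hval⟩, ?_⟩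
  · rintro rfl
    exact hnuc.ne' (hzero.symm.trans hval)
  · rintro b ⟨-, hb⟩
    rcases lt_trichotomy b lam with h | h | h
    · exact absurd hb (hstrict _ _ h hval)
    · exact h
    · exact absurd hval (hstrict _ _ h hb)

/-- the proximal mapping of the spectral norm. If `‖Q‖_* > 1`
(i.e. the sum of the singular values of `Q` exceeds 1), then there is a unique
`λ* > 0` with `Σ_i [σ_i(Q) − λ*]₊ = 1`, and
`Prox_θ(Q) = U [Diag(min(σ_i(Q), λ*)) 0] Vᵀ` with `λ* = ‖Prox_θ(Q)‖₂`. -/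
theorem prox_specNorm_formula {m n : ℕ} (hmn : m ≤ n)
    (Q : Matrix (Fin m) (Fin n) ℝ)
    (U : Matrix (Fin m) (Fin m) ℝ) (V : Matrix (Fin n) (Fin n) ℝ) (σ : Fin m → ℝ)
    (hU : Uᵀ * U = 1) (hV : Vᵀ * V = 1)
    (hσa : Antitone σ) (hσ0 : ∀ i, 0 ≤ σ i)
    (hSVD : Q = U * (diagRect σ : Matrix (Fin m) (Fin n) ℝ) * Vᵀ)
    (hnuc : 1 < ∑ i, σ i) :
    (∃! lam : ℝ, 0 < lam ∧ ∑ i, max (σ i - lam) 0 = 1) ∧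
    (∀ lam : ℝ, 0 < lam → ∑ i, max (σ i - lam) 0 = 1 →
      prox specNorm Q =
        U * (diagRect (fun i => min (σ i) lam) : Matrix (Fin m) (Fin n) ℝ) * Vᵀ ∧
      lam = specNorm (prox specNorm Q)) := by
  refine ⟨existsUnique_sum_max_sub_eq_one hσ0 hnuc, fun lam hlam hsum => ?_⟩
  set P : Matrix (Fin m) (Fin n) ℝ :=
    U * (diagRect (fun i => min (σ i) lam) : Matrix (Fin m) (Fin n) ℝ) * Vᵀ with hP
  have hQP : Q - P =
      U * (diagRect (fun i => max (σ i - lam) 0) : Matrix (Fin m) (Fin n) ℝ) * Vᵀ := by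
    rw [hSVD, hP, ← Matrix.sub_mul, ← Matrix.mul_sub]
    congr 2
    ext i j
    simp only [diagRect, Matrix.sub_apply, Matrix.of_apply]
    split_ifs
    · rcases le_total (σ i) lam with h | h
      · rw [min_eq_left h, max_eq_right (by linarith), sub_self]
      · rw [min_eq_right h, max_eq_left (by linarith)]
    · simp
  have hdual : ∀ X, minner (Q - P) X ≤ specNorm X := fun X => by
    have := minner_svd_le hmn hU hV (fun i => le_max_right (σ i - lam) 0) X
    rwa [hsum, one_mul, ← hQP] at this
  have hpair : minner (Q - P) P = lam := by
    have hdiag : Uᵀ * P * V = diagRect fun i => min (σ i) lam := by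
      rw [hP, Matrix.mul_assoc, Matrix.mul_assoc, hV, Matrix.mul_one, ← Matrix.mul_assoc, hU,
        Matrix.one_mul]
    rw [hQP, minner_svd, hdiag, minner_diagRect hmn]
    calc _ = ∑ i, max (σ i - lam) 0 * lam := by
          refine Finset.sum_congr rfl fun i _ => ?_
          rcases le_total (σ i) lam with h | h
          · simp [max_eq_right (show σ i - lam ≤ 0 by linarith)]
          · simp [diagRect, min_eq_right h]
      _ = lam := by rw [← Finset.sum_mul, hsum, one_mul]
  have hnorm : specNorm P = lam :=
    le_antisymm (specNorm_svd_le hmn hU hV (fun i => le_min (hσ0 i) hlam.le)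
      (fun i => min_le_right _ _) hlam.le) (hpair ▸ hdual P)
  have hprox : prox specNorm Q = P := by
    refine prox_eq_of_subgradient fun X => ?_
    have hlin : minner (Q - P) (X - P) = minner (Q - P) X - minner (Q - P) P := by
      simp [minner, Matrix.mul_sub]
    linarith [hdual X]
  exact ⟨hprox, by rw [hprox, hnorm]⟩
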